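/- Let H be the maximal square inscribed in the n×n grid with sides parallel to the lines y = ±x (the set of lattice points (i,j) with |i − (n+1)/2| + |j − (n+1)/2| ≤ n/2). Then the maximum discrepancy F(H) satisfies F(H) ≥ (1+o(1))·(2/3)·√(2/π)·n^{3/2} and F(H) ≤ (2 ln 2)^{1/2}·n^{3/2}. -/

import Mathlib

/-- The maximal square inscribed in the `n × n` grid with sides parallel to
`y = ±x`: lattice points `(i,j)` (1-indexed) with
`|2i - (n+1)| + |2j - (n+1)| ≤ n`. -/
def rotBoard (n : ℕ) : Finset (Fin n × Fin n) :=
  Finset.univ.filter (fun p =>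
    |2 * ((p.1 : ℤ) + 1) - (n + 1)| + |2 * ((p.2 : ℤ) + 1) - (n + 1)| ≤ (n : ℤ))

open Finset

/-- One step of the simple random walk on `ℤ`, acting on functions. -/
noncomputable def symmAvg (f : ℤ → ℝ) : ℤ → ℝ := fun s => (f (s + 1) + f (s - 1)) / 2

theorem sum_signs_eq {ι : Type*} [Fintype ι] [DecidableEq ι] (ε : ι → ℤ) (I : Finset ι)
    (hε : ∀ p ∈ I, ε p = 1 ∨ ε p = -1) (f : ℤ → ℝ) (s : ℤ) :
    ∑ a : ι → ℤˣ, f (s + ∑ p ∈ I, ε p * (a p : ℤ)) =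
      Fintype.card (ι → ℤˣ) * (symmAvg^[#I] f) s := by
  induction I using Finset.induction_on generalizing f with
  | empty => simp
  | insert p I hp ih =>
    have hflip : ∑ a : ι → ℤˣ, f (s + ∑ q ∈ insert p I, ε q * (a q : ℤ)) =
        ∑ a : ι → ℤˣ, f (s + (-(ε p * (a p : ℤ)) + ∑ q ∈ I, ε q * (a q : ℤ))) := by
      rw [← Equiv.sum_comp (Equiv.mulLeft (Pi.mulSingle p (-1 : ℤˣ)))]
      refine sum_congr rfl fun a _ => ?_
      rw [sum_insert hp]
      congr 3
      · simp
      · refine sum_congr rfl fun q hq => ?_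
        have : q ≠ p := fun h => hp (h ▸ hq)
        simp [this]
    have havg : ∑ a : ι → ℤˣ, f (s + ∑ q ∈ insert p I, ε q * (a q : ℤ)) =
        ∑ a : ι → ℤˣ, symmAvg f (s + ∑ q ∈ I, ε q * (a q : ℤ)) := by
      have h2 : ∑ a : ι → ℤˣ, f (s + ∑ q ∈ insert p I, ε q * (a q : ℤ)) =
          (∑ a : ι → ℤˣ, f (s + ∑ q ∈ insert p I, ε q * (a q : ℤ)) +
            ∑ a : ι → ℤˣ, f (s + (-(ε p * (a p : ℤ)) + ∑ q ∈ I, ε q * (a q : ℤ)))) / 2 := by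
        rw [← hflip]; ring
      rw [h2, ← sum_add_distrib, sum_div]
      refine sum_congr rfl fun a _ => ?_
      rw [sum_insert hp]
      have hs : ε p * (a p : ℤ) = 1 ∨ ε p * (a p : ℤ) = -1 := by
        rcases hε p (mem_insert_self _ _) with h | h <;>
          rcases Int.units_eq_one_or (a p) with h' | h' <;> simp [h, h']
      generalize ∑ q ∈ I, ε q * (a q : ℤ) = r
      unfold symmAvg
      rcases hs with h | h <;> rw [h]
      · rw [show s + (1 + r) = s + r + 1 by ring, show s + (-1 + r) = s + r - 1 by ring]
      · rw [show s + (-1 + r) = s + r - 1 by ring, show s + (- -1 + r) = s + r + 1 by ring]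
        ring
    rw [havg, ih (fun q hq => hε q (mem_insert_of_mem hq)), card_insert_of_notMem hp,
      Function.iterate_succ_apply]

theorem symmAvg_iterate_exp (t : ℝ) (m : ℕ) (s : ℤ) :
    (symmAvg^[m] fun k => Real.exp (t * k)) s = Real.cosh t ^ m * Real.exp (t * s) := by
  induction m generalizing s with
  | zero => simp
  | succ m ih =>
    rw [Function.iterate_succ_apply', symmAvg, ih, ih, Real.cosh_eq]
    push_cast
    rw [mul_add, mul_sub, sub_eq_add_neg, Real.exp_add, Real.exp_add, mul_one, pow_succ]
    ring

/-- Chernoff's bound and the union bound over a set `P` of sign patterns. -/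
theorem exists_signs_sum_le {ι : Type*} [Fintype ι] [DecidableEq ι] (I : Finset ι)
    (hI : I.Nonempty) (P : Finset (ι → ℤ)) (hP : ∀ s ∈ P, ∀ p ∈ I, s p = 1 ∨ s p = -1)
    {μ : ℝ} (hμ : 0 < μ) (hcard : (#P : ℝ) ≤ Real.exp (μ ^ 2 / (2 * #I))) :
    ∃ a : ι → ℤˣ, ∀ s ∈ P, ((∑ p ∈ I, s p * (a p : ℤ) : ℤ) : ℝ) ≤ μ := by
  by_contra! hbad
  have hN : (0 : ℝ) < #I := by exact_mod_cast hI.card_pos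
  set t : ℝ := μ / #I with ht
  have ht0 : 0 < t := by positivity
  have hC : (0 : ℝ) < Fintype.card (ι → ℤˣ) := by exact_mod_cast Fintype.card_pos
  have hsum : ∑ a : ι → ℤˣ, ∑ s ∈ P,
      Real.exp (t * ((∑ p ∈ I, s p * (a p : ℤ) : ℤ) : ℝ)) =
        Fintype.card (ι → ℤˣ) * (#P * Real.cosh t ^ #I) := by
    rw [sum_comm]
    have : ∀ s ∈ P, ∑ a : ι → ℤˣ, Real.exp (t * ((∑ p ∈ I, s p * (a p : ℤ) : ℤ) : ℝ)) =
        Fintype.card (ι → ℤˣ) * Real.cosh t ^ #I := by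
      intro s hs
      have := sum_signs_eq s I (hP s hs) (fun k => Real.exp (t * k)) 0
      rw [symmAvg_iterate_exp] at this
      simpa using this
    rw [sum_congr rfl this, sum_const, nsmul_eq_mul]
    ring
  have hlow : ∑ _a : ι → ℤˣ, Real.exp (t * μ) < ∑ a : ι → ℤˣ, ∑ s ∈ P,
      Real.exp (t * ((∑ p ∈ I, s p * (a p : ℤ) : ℤ) : ℝ)) := by
    refine sum_lt_sum_of_nonempty univ_nonempty fun a _ => ?_
    obtain ⟨s, hs, hlt⟩ := hbad a
    refine lt_of_lt_of_le (Real.exp_lt_exp.2 (mul_lt_mul_of_pos_left hlt ht0)) ?_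
    exact single_le_sum (f := fun s : ι → ℤ =>
      Real.exp (t * ((∑ p ∈ I, s p * (a p : ℤ) : ℤ) : ℝ)))
      (fun _ _ => (Real.exp_pos _).le) hs
  rw [hsum, sum_const, nsmul_eq_mul, card_univ, mul_lt_mul_iff_right₀ hC] at hlow
  have hcosh : Real.cosh t ^ #I ≤ Real.exp (μ ^ 2 / (2 * #I)) := by
    refine (pow_le_pow_left₀ (Real.cosh_pos t).le (Real.cosh_le_exp_half_sq t) _).trans
      (le_of_eq ?_)
    rw [← Real.exp_nat_mul, ht]
    congr 1
    field_simp
  have hprod : (#P : ℝ) * Real.cosh t ^ #I ≤ Real.exp (t * μ) := by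
    refine (mul_le_mul hcard hcosh (by positivity) (by positivity)).trans (le_of_eq ?_)
    rw [← Real.exp_add, ht]
    congr 1
    field_simp
    norm_num
  exact absurd hlow hprod.not_gt

/-- The products `x i * y j` of signs with `x = 1` off `R` and `y = 1` off `C`. -/
def signPatterns {α β : Type*} [Fintype α] [Fintype β] [DecidableEq α] [DecidableEq β]
    (R : Finset α) (C : Finset β) : Finset (α × β → ℤ) :=
  (R.powerset ×ˢ C.powerset).image fun q p =>
    (if p.1 ∈ q.1 then -1 else 1) * (if p.2 ∈ q.2 then -1 else 1)

theorem card_signPatterns_le {α β : Type*} [Fintype α] [Fintype β] [DecidableEq α]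
    [DecidableEq β] (R : Finset α) (C : Finset β) : #(signPatterns R C) ≤ 2 ^ (#R + #C) := by
  refine card_image_le.trans (le_of_eq ?_)
  rw [card_product, card_powerset, card_powerset, pow_add]

theorem exists_coloring_sum_le {α β : Type*} [Fintype α] [Fintype β] [DecidableEq α]
    [DecidableEq β] (I : Finset (α × β)) (hI : I.Nonempty) (R : Finset α) (C : Finset β)
    {μ : ℝ} (hμ : 0 < μ) (hcard : ((#R + #C : ℕ) : ℝ) * Real.log 2 ≤ μ ^ 2 / (2 * #I)) :
    ∃ a : α × β → ℤ, (∀ p, a p = 1 ∨ a p = -1) ∧ ∀ (x : α → ℤ) (y : β → ℤ),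
      (∀ i, x i = 1 ∨ x i = -1) → (∀ j, y j = 1 ∨ y j = -1) →
      (∀ p ∈ I, p.1 ∉ R → x p.1 = 1) → (∀ p ∈ I, p.2 ∉ C → y p.2 = 1) →
      ((∑ p ∈ I, a p * x p.1 * y p.2 : ℤ) : ℝ) ≤ μ := by
  obtain ⟨a, ha⟩ := exists_signs_sum_le I hI (signPatterns R C) (by
    intro s hs p _
    obtain ⟨q, -, rfl⟩ := mem_image.1 hs
    dsimp only
    split_ifs <;> simp) hμ (by
    have h1 : (#(signPatterns R C) : ℝ) ≤ (2 : ℝ) ^ (#R + #C) := by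
      exact_mod_cast card_signPatterns_le R C
    refine h1.trans ?_
    rw [← Real.exp_log (show (0 : ℝ) < 2 ^ (#R + #C) by positivity), Real.log_pow]
    exact Real.exp_le_exp.2 hcard)
  refine ⟨fun p => a p, fun p => ?_, fun x y hx hy hxR hyC => ?_⟩
  · rcases Int.units_eq_one_or (a p) with h | h <;> simp [h]
  refine le_trans (le_of_eq ?_) (ha (fun p =>
    (if p.1 ∈ R.filter (x · = -1) then -1 else 1) *
      (if p.2 ∈ C.filter (y · = -1) then -1 else 1))
    (mem_image.2 ⟨(R.filter (x · = -1), C.filter (y · = -1)), by simp, rfl⟩))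
  congr 1
  refine sum_congr rfl fun p hp => ?_
  have h1 : (if p.1 ∈ R.filter (x · = -1) then (-1 : ℤ) else 1) = x p.1 := by
    by_cases h : p.1 ∈ R
    · rcases hx p.1 with h' | h' <;> simp [h, h']
    · simp [h, hxR p hp h]
  have h2 : (if p.2 ∈ C.filter (y · = -1) then (-1 : ℤ) else 1) = y p.2 := by
    by_cases h : p.2 ∈ C
    · rcases hy p.2 with h' | h' <;> simp [h, h']
    · simp [h, hyC p hp h]
  rw [h1, h2]
  ring

theorem mem_rotBoard {n : ℕ} {p : Fin n × Fin n} :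
    p ∈ rotBoard n ↔ 2 * ((p.1 : ℕ) + p.2 + 1) ≤ 3 * n ∧ 2 * (p.1 : ℕ) ≤ 2 * p.2 + n ∧
      2 * (p.2 : ℕ) ≤ 2 * p.1 + n ∧ n ≤ 2 * ((p.1 : ℕ) + p.2 + 1) := by
  simp only [rotBoard, mem_filter, mem_univ, true_and]
  rcases abs_cases (2 * ((p.1 : ℤ) + 1) - (n + 1)) with h | h <;>
    rcases abs_cases (2 * ((p.2 : ℤ) + 1) - (n + 1)) with h' | h' <;>
    rw [h.1, h'.1] <;> omega

/-- The columns of the cells of `rotBoard n` in row `i`. -/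
def rotRow (n : ℕ) (i : Fin n) : Finset (Fin n) := univ.filter fun j => (i, j) ∈ rotBoard n

theorem sum_rotBoard {M : Type*} [AddCommMonoid M] {n : ℕ} (f : Fin n × Fin n → M) :
    ∑ p ∈ rotBoard n, f p = ∑ i, ∑ j ∈ rotRow n i, f (i, j) := by
  simp only [rotRow, sum_filter]
  rw [← Fintype.sum_prod_type', ← sum_filter]
  simp

theorem card_rotRow (n : ℕ) (i : Fin n) :
    #(rotRow n i) = 2 * min (i : ℕ) (n - 1 - i) + 2 - n % 2 := by
  have hi := i.isLt
  have hmap : (rotRow n i).map Fin.valEmbedding =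
      Icc ((n - 1) / 2 - min (i : ℕ) (n - 1 - i)) (n / 2 + min (i : ℕ) (n - 1 - i)) := by
    ext j
    simp only [mem_map, rotRow, mem_filter, mem_univ, true_and, mem_rotBoard, mem_Icc,
      Fin.valEmbedding_apply]
    constructor
    · rintro ⟨j, h, rfl⟩
      have hj := j.isLt
      omega
    · intro h
      exact ⟨⟨j, by omega⟩, by dsimp only; omega, rfl⟩
  rw [← card_map Fin.valEmbedding, hmap, Nat.card_Icc]
  omega

theorem sum_range_min {M : Type*} [AddCommMonoid M] (g : ℕ → M) (h : ℕ) :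
    ∑ i ∈ range (2 * h), g (min i (2 * h - 1 - i)) = 2 • ∑ i ∈ range h, g i := by
  rw [two_mul, sum_range_add, two_nsmul]
  congr 1
  · refine sum_congr rfl fun i hi => ?_
    have := mem_range.1 hi
    congr 1; omega
  · rw [← sum_range_reflect]
    refine sum_congr rfl fun i hi => ?_
    have := mem_range.1 hi
    congr 1; omega

theorem sum_range_min_odd {M : Type*} [AddCommMonoid M] (g : ℕ → M) (h : ℕ) :
    ∑ i ∈ range (2 * h + 1), g (min i (2 * h + 1 - 1 - i)) = 2 • ∑ i ∈ range h, g i + g h := by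
  rw [show 2 * h + 1 = h + 1 + h by ring, sum_range_add, two_nsmul, sum_range_succ, add_right_comm]
  congr 1
  · congr 1
    · refine sum_congr rfl fun i hi => ?_
      have := mem_range.1 hi
      congr 1; omega
    · rw [← sum_range_reflect]
      refine sum_congr rfl fun i hi => ?_
      have := mem_range.1 hi
      congr 1; omega
  · congr 1; omega

theorem card_rotBoard (n : ℕ) :
    #(rotBoard n) = ∑ i ∈ range n, (2 * min i (n - 1 - i) + 2 - n % 2) := by
  rw [card_eq_sum_ones, sum_rotBoard, ← Fin.sum_univ_eq_sum_range
    (fun i => 2 * min i (n - 1 - i) + 2 - n % 2)]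
  simp [card_rotRow]

theorem card_rotBoard_even (h : ℕ) : #(rotBoard (2 * h)) = 2 * h ^ 2 + 2 * h := by
  rw [card_rotBoard, sum_range_min (fun d => 2 * d + 2 - 2 * h % 2)]
  have : 2 * h % 2 = 0 := by omega
  simp only [this]
  induction h with
  | zero => simp
  | succ h ih =>
    have := ih (by omega)
    rw [sum_range_succ, smul_add, this]
    simp only [smul_eq_mul, Nat.sub_zero]
    ring

theorem card_rotBoard_odd (h : ℕ) : #(rotBoard (2 * h + 1)) = 2 * h ^ 2 + 2 * h + 1 := by
  rw [card_rotBoard, sum_range_min_odd (fun d => 2 * d + 2 - (2 * h + 1) % 2)]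
  have : (2 * h + 1) % 2 = 1 := by omega
  simp only [this]
  have : ∑ i ∈ range h, (2 * i + 2 - 1) = h ^ 2 := by
    induction h with
    | zero => simp
    | succ h ih =>
      rw [sum_range_succ, ih (by omega)]
      have : 2 * h + 2 - 1 = 2 * h + 1 := by omega
      rw [this]; ring
  rw [this, smul_eq_mul]
  omega
theorem symmAvg_iterate_add (f g : ℤ → ℝ) (m : ℕ) (s : ℤ) :
    (symmAvg^[m] fun k => f k + g k) s = (symmAvg^[m] f) s + (symmAvg^[m] g) s := by
  induction m generalizing s with
  | zero => simp
  | succ m ih =>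
    simp only [Function.iterate_succ_apply', symmAvg, ih]
    ring

theorem symmAvg_abs :
    symmAvg (fun k => |(k : ℝ)|) = fun k : ℤ => |(k : ℝ)| + if k = 0 then 1 else 0 := by
  funext k
  simp only [symmAvg]
  push_cast
  rcases lt_trichotomy k 0 with h | rfl | h
  · have hk : (k : ℝ) ≤ -1 := by exact_mod_cast Int.le_sub_one_of_lt h
    rw [abs_of_nonpos (by linarith), abs_of_nonpos (by linarith), abs_of_nonpos (by linarith),
      if_neg h.ne]
    ring
  · simp
  · have hk : (1 : ℝ) ≤ k := by exact_mod_cast h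
    rw [abs_of_nonneg (by linarith), abs_of_nonneg (by linarith), abs_of_nonneg (by linarith),
      if_neg h.ne']
    ring

/-- `P (S_m = s)` for the simple random walk `S_m` on `ℤ`. -/
noncomputable def walkProb (m : ℕ) (s : ℤ) : ℝ := (symmAvg^[m] fun k => if k = 0 then 1 else 0) s

/-- `E |S_m|` for the simple random walk `S_m` on `ℤ`. -/
noncomputable def walkAbs (m : ℕ) : ℝ := (symmAvg^[m] fun k => |(k : ℝ)|) 0

theorem walkProb_succ (m : ℕ) (s : ℤ) :
    walkProb (m + 1) s = (walkProb m (s + 1) + walkProb m (s - 1)) / 2 := by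
  simp only [walkProb, Function.iterate_succ_apply', symmAvg]

theorem walkAbs_succ (m : ℕ) : walkAbs (m + 1) = walkAbs m + walkProb m 0 := by
  rw [walkAbs, Function.iterate_succ_apply, symmAvg_abs, symmAvg_iterate_add]
  rfl

theorem walkProb_nonneg (m : ℕ) (s : ℤ) : 0 ≤ walkProb m s := by
  induction m generalizing s with
  | zero => simp only [walkProb, Function.iterate_zero, id]; split_ifs <;> norm_num
  | succ m ih => rw [walkProb_succ]; have := ih (s + 1); have := ih (s - 1); positivity

theorem walkProb_eq_zero (m : ℕ) (s : ℤ) (hs : s < -m) : walkProb m s = 0 := by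
  induction m generalizing s with
  | zero =>
    have : s ≠ 0 := by simp at hs; omega
    simp [walkProb, this]
  | succ m ih =>
    push_cast at hs
    rw [walkProb_succ, ih _ (by omega), ih _ (by omega)]
    simp

theorem walkProb_two_mul_sub (m i : ℕ) : walkProb m (2 * i - m) = m.choose i / 2 ^ m := by
  induction m generalizing i with
  | zero =>
    rcases i with _ | i
    · simp [walkProb]
    · have : (2 * ((i : ℤ) + 1)) ≠ 0 := by omega
      simp [walkProb, this]
  | succ m ih =>
    rw [walkProb_succ]
    have h1 : walkProb m (2 * i - (m + 1 : ℕ) + 1) = m.choose i / 2 ^ m := by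
      rw [← ih]; congr 1; push_cast; ring
    rw [h1]
    rcases i with _ | i
    · rw [walkProb_eq_zero _ _ (by push_cast; omega)]
      simp [pow_succ]
      field_simp
    · have h2 : walkProb m (2 * (i + 1 : ℕ) - (m + 1 : ℕ) - 1) = m.choose i / 2 ^ m := by
        rw [← ih]; congr 1; push_cast; ring
      rw [h2, Nat.choose_succ_succ]
      push_cast
      rw [pow_succ]
      field_simp
      ring

theorem walkProb_two_mul_zero (k : ℕ) : walkProb (2 * k) 0 = k.centralBinom / 4 ^ k := by
  have := walkProb_two_mul_sub (2 * k) k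
  rw [show (2 * (k : ℤ) - (2 * k : ℕ)) = 0 by push_cast; ring, pow_mul] at this
  rw [this, Nat.centralBinom_eq_two_mul_choose]
  norm_num

theorem walkProb_odd_zero (k : ℕ) : walkProb (2 * k + 1) 0 = 0 := by
  have key : ∀ (m : ℕ) (s : ℤ), (m + s) % 2 ≠ 0 → walkProb m s = 0 := by
    intro m
    induction m with
    | zero =>
      intro s hs
      have : s ≠ 0 := by rintro rfl; simp at hs
      simp [walkProb, this]
    | succ m ih =>
      intro s hs
      push_cast at hs
      rw [walkProb_succ, ih _ (by omega), ih _ (by omega)]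
      simp
  exact key _ _ (by push_cast; omega)

theorem walkAbs_mono : Monotone walkAbs :=
  monotone_nat_of_le_succ fun m => by
    rw [walkAbs_succ]; linarith [walkProb_nonneg m 0]

theorem walkAbs_odd (d : ℕ) : walkAbs (2 * d + 1) = (2 * d + 1) * (d.centralBinom / 4 ^ d) := by
  induction d with
  | zero =>
    rw [Nat.mul_zero, walkAbs_succ]
    simp [walkProb, walkAbs]
  | succ d ih =>
    rw [walkAbs_succ, walkProb_two_mul_zero, show 2 * (d + 1) = 2 * d + 1 + 1 by ring,
      walkAbs_succ, walkProb_odd_zero, ih]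
    have h : ((d : ℝ) + 1) * (d + 1).centralBinom = 2 * (2 * d + 1) * d.centralBinom := by
      exact_mod_cast Nat.succ_mul_centralBinom_succ d
    have h' : ((d + 1).centralBinom : ℝ) = 2 * (2 * d + 1) * d.centralBinom / (d + 1) := by
      field_simp; linarith
    rw [h', pow_succ]
    push_cast
    field_simp
    ring

theorem wallis_eq_centralBinom (k : ℕ) :
    Real.Wallis.W k * ((2 * k + 1) * (k.centralBinom / 4 ^ k) ^ 2) = 1 := by
  induction k with
  | zero => simp [Real.Wallis.W]
  | succ k ih =>
    have h : ((k : ℝ) + 1) * (k + 1).centralBinom = 2 * (2 * k + 1) * k.centralBinom := by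
      exact_mod_cast Nat.succ_mul_centralBinom_succ k
    have h' : ((k + 1).centralBinom : ℝ) = 2 * (2 * k + 1) * k.centralBinom / (k + 1) := by
      field_simp; linarith
    rw [Real.Wallis.W_succ, h', pow_succ]
    refine Eq.trans ?_ ih
    push_cast
    field_simp
    ring

theorem le_walkAbs {d m : ℕ} (h : 2 * d + 1 ≤ m) : 2 / √Real.pi * √d ≤ walkAbs m := by
  refine le_trans ?_ (walkAbs_mono h)
  rw [walkAbs_odd]
  set b : ℝ := d.centralBinom / 4 ^ d with hb
  have hb0 : 0 ≤ b := by positivity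
  have hpi := Real.pi_pos
  have hW := wallis_eq_centralBinom d
  have hW' := Real.Wallis.W_le d
  rw [← hb] at hW
  have h1 : 1 ≤ Real.pi / 2 * ((2 * d + 1) * b ^ 2) := by
    refine hW.symm.le.trans ?_
    gcongr
  refine le_of_sq_le_sq ?_ (by positivity)
  rw [mul_pow, div_pow, Real.sq_sqrt hpi.le, Real.sq_sqrt (by positivity), mul_pow,
    div_mul_eq_mul_div, div_le_iff₀ hpi]
  nlinarith [mul_le_mul_of_nonneg_left h1 (show (0 : ℝ) ≤ 2 * d + 1 by positivity)]

theorem le_sum_sqrt (h : ℕ) : 2 / 3 * (h * √h) ≤ ∑ d ∈ range (h + 1), √d := by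
  induction h with
  | zero => simp
  | succ h ih =>
    rw [sum_range_succ]
    have hu := Real.sq_sqrt (show (0 : ℝ) ≤ (h + 1 : ℕ) by positivity)
    have hv := Real.sq_sqrt (show (0 : ℝ) ≤ h by positivity)
    push_cast at hu ih ⊢
    set u := √((h : ℝ) + 1)
    set v := √(h : ℝ)
    have hu0 : 0 ≤ u := Real.sqrt_nonneg _
    have hv0 : 0 ≤ v := Real.sqrt_nonneg _
    have h0 : (h : ℝ) = v ^ 2 := hv.symm
    have h1 : (h : ℝ) + 1 = u ^ 2 := hu.symm
    have h2 : u ^ 2 - v ^ 2 = 1 := by linarith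
    rw [h1]
    rw [h0] at ih
    have h3 : u = u * (u ^ 2 - v ^ 2) := by rw [h2, mul_one]
    nlinarith [mul_nonneg (sq_nonneg (u - v)) (show 0 ≤ u + 2 * v by positivity)]

theorem exists_signs_le_sum_rotBoard {n : ℕ} (a : Fin n × Fin n → ℤ)
    (ha : ∀ p ∈ rotBoard n, a p = 1 ∨ a p = -1) :
    ∃ x y : Fin n → ℤ, (∀ i, x i = 1 ∨ x i = -1) ∧ (∀ j, y j = 1 ∨ y j = -1) ∧
      ∑ i, walkAbs #(rotRow n i) ≤ ((∑ p ∈ rotBoard n, a p * x p.1 * y p.2 : ℤ) : ℝ) := by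
  have havg : ∑ _y : Fin n → ℤˣ, ∑ i, walkAbs #(rotRow n i) ≤
      ∑ y : Fin n → ℤˣ, ∑ i, |((∑ j ∈ rotRow n i, a (i, j) * (y j : ℤ) : ℤ) : ℝ)| := by
    rw [sum_comm, sum_comm (s := (univ : Finset (Fin n → ℤˣ)))]
    refine (sum_congr rfl fun i _ => ?_).le
    have := sum_signs_eq (fun j => a (i, j)) (rotRow n i)
      (fun j hj => ha _ (mem_filter.1 hj).2) (fun k => |(k : ℝ)|) 0
    simp only [zero_add] at this
    rw [this, sum_const, nsmul_eq_mul, card_univ]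
    rfl
  obtain ⟨y, -, hy⟩ := exists_le_of_sum_le univ_nonempty havg
  refine ⟨fun i => if 0 ≤ ∑ j ∈ rotRow n i, a (i, j) * (y j : ℤ) then 1 else -1,
    fun j => y j, fun i => ?_, fun j => ?_, hy.trans (le_of_eq ?_)⟩
  · dsimp only
    split_ifs <;> simp
  · rcases Int.units_eq_one_or (y j) with h | h <;> simp [h]
  rw [sum_rotBoard, Int.cast_sum]
  refine sum_congr rfl fun i _ => ?_
  rw [← Int.cast_abs]
  congr 1
  dsimp only
  split_ifs with h
  · rw [abs_of_nonneg h]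
    simp
  · rw [abs_of_neg (not_le.1 h), ← sum_neg_distrib]
    simp

theorem le_sum_walkAbs {n : ℕ} (hn : 3 ≤ n) :
    2 / 3 * √(2 / Real.pi) * (((n : ℝ) - 6) * √n) ≤ ∑ i, walkAbs #(rotRow n i) := by
  have h1 : ∑ i ∈ range n, 2 / √Real.pi * √((min i (n - 1 - i) : ℕ) : ℝ) ≤
      ∑ i, walkAbs #(rotRow n i) := by
    rw [← Fin.sum_univ_eq_sum_range (fun i => 2 / √Real.pi * √((min i (n - 1 - i) : ℕ) : ℝ))]
    refine sum_le_sum fun i _ => le_walkAbs ?_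
    rw [card_rotRow]
    omega
  refine le_trans ?_ h1
  rw [← mul_sum]
  have h2 : 2 * ∑ d ∈ range (n / 2), √(d : ℝ) ≤
      ∑ i ∈ range n, √((min i (n - 1 - i) : ℕ) : ℝ) := by
    obtain ⟨h, rfl | rfl⟩ := Nat.even_or_odd' n
    · rw [sum_range_min (fun d => √(d : ℝ)), show 2 * h / 2 = h by omega]
      simp
    · rw [sum_range_min_odd (fun d => √(d : ℝ)), show (2 * h + 1) / 2 = h by omega]
      simp
  obtain ⟨h, hh⟩ : ∃ h, n / 2 = h + 1 := ⟨n / 2 - 1, by omega⟩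
  rw [hh] at h2
  have h3 := le_sum_sqrt h
  have hn' : (3 : ℝ) ≤ n := by exact_mod_cast hn
  have hhn : ((n : ℝ) - 3) / 2 ≤ h := by
    have : n ≤ 2 * h + 3 := by omega
    have : (n : ℝ) ≤ 2 * h + 3 := by exact_mod_cast this
    linarith
  have hpi := Real.pi_pos
  have h4 : ((n : ℝ) - 3) / 2 * √(((n : ℝ) - 3) / 2) ≤ h * √h := by
    gcongr
  have h5 : ((n : ℝ) - 6) * √n ≤ ((n : ℝ) - 3) * √((n : ℝ) - 3) := by
    have h6 : √(n : ℝ) * ((n - 3) / n) ≤ √((n : ℝ) - 3) := by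
      refine Real.le_sqrt_of_sq_le ?_
      rw [mul_pow, Real.sq_sqrt (by positivity), div_pow]
      field_simp
      nlinarith
    have h7 : ((n : ℝ) - 6) * √n ≤ (n - 3) * (√n * ((n - 3) / n)) := by
      have : (n : ℝ) - 6 ≤ (n - 3) * ((n - 3) / n) := by
        field_simp
        nlinarith
      nlinarith [Real.sqrt_nonneg (n : ℝ)]
    exact h7.trans (mul_le_mul_of_nonneg_left h6 (by linarith))
  have h8 : 2 / 3 * √(2 / Real.pi) * (((n : ℝ) - 3) * √((n : ℝ) - 3)) =
      2 / √Real.pi * (2 * (2 / 3 * (((n : ℝ) - 3) / 2 * √(((n : ℝ) - 3) / 2)))) := by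
    rw [Real.sqrt_div (by norm_num), Real.sqrt_div (by linarith)]
    have : √(2 : ℝ) ^ 2 = 2 := Real.sq_sqrt (by norm_num)
    field_simp
    rw [this]
  calc _ ≤ 2 / 3 * √(2 / Real.pi) * (((n : ℝ) - 3) * √((n : ℝ) - 3)) := by gcongr
    _ ≤ _ := by
      rw [h8]
      gcongr
      linarith

theorem rpow_three_halves {x : ℝ} (hx : 0 ≤ x) : x ^ ((3 : ℝ) / 2) = x * √x := by
  rw [show (3 : ℝ) / 2 = 1 + 1 / 2 by norm_num, Real.rpow_add' hx (by norm_num), Real.rpow_one,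
    Real.sqrt_eq_rpow]

theorem le_discrepancy_rotBoard (ε : ℝ) (hε : 0 < ε) : ∃ N : ℕ, ∀ n : ℕ, N ≤ n →
    ∀ a : Fin n × Fin n → ℤ, (∀ p ∈ rotBoard n, a p = 1 ∨ a p = -1) →
      ∃ x y : Fin n → ℤ,
        (∀ i, x i = 1 ∨ x i = -1) ∧ (∀ j, y j = 1 ∨ y j = -1) ∧
        (2/3 * Real.sqrt (2 / Real.pi) - ε) * (n : ℝ) ^ ((3 : ℝ)/2)
          ≤ ((∑ p ∈ rotBoard n, a p * x p.1 * y p.2 : ℤ) : ℝ) := by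
  obtain ⟨N, hN⟩ := exists_nat_ge (6 / ε)
  refine ⟨max 3 N, fun n hn a ha => ?_⟩
  obtain ⟨x, y, hx, hy, h⟩ := exists_signs_le_sum_rotBoard a ha
  refine ⟨x, y, hx, hy, le_trans ?_ ((le_sum_walkAbs (le_of_max_le_left hn)).trans h)⟩
  rw [rpow_three_halves (by positivity)]
  have hNn : (N : ℝ) ≤ n := by exact_mod_cast le_of_max_le_right hn
  have hεn : 6 ≤ n * ε := (div_le_iff₀ hε).1 (hN.trans hNn)
  have hc : 2 / 3 * √(2 / Real.pi) ≤ 1 := by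
    have : √(2 / Real.pi) ≤ 1 := by
      refine Real.sqrt_le_iff.2 ⟨zero_le_one, ?_⟩
      rw [one_pow, div_le_one Real.pi_pos]
      linarith [Real.pi_gt_three]
    linarith
  nlinarith [mul_le_mul_of_nonneg_right (show 6 * (2 / 3 * √(2 / Real.pi)) ≤ n * ε by linarith)
    (Real.sqrt_nonneg (n : ℝ))]

theorem discrepancy_rotBoard_odd_le (h : ℕ) :
    ∃ a : Fin (2 * h + 1) × Fin (2 * h + 1) → ℤ, (∀ p, a p = 1 ∨ a p = -1) ∧
      ∀ x y : Fin (2 * h + 1) → ℤ,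
        (∀ i, x i = 1 ∨ x i = -1) → (∀ j, y j = 1 ∨ y j = -1) →
        ((∑ p ∈ rotBoard (2 * h + 1), a p * x p.1 * y p.2 : ℤ) : ℝ)
          ≤ √(2 * Real.log 2) * ((2 * h + 1 : ℕ) : ℝ) ^ ((3 : ℝ)/2) := by
  have hL : 0 < Real.log 2 := Real.log_pos (by norm_num)
  set μ : ℝ := √(2 * Real.log 2) * ((2 * h + 1 : ℕ) : ℝ) ^ ((3 : ℝ)/2) with hμ
  have hμ0 : 0 < μ := by positivity
  have hμ2 : μ ^ 2 = 2 * Real.log 2 * (2 * h + 1) ^ 3 := by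
    rw [hμ, rpow_three_halves (by positivity), mul_pow, mul_pow, Real.sq_sqrt (by positivity),
      Real.sq_sqrt (by positivity)]
    push_cast
    ring
  obtain ⟨a, ha, hsum⟩ := exists_coloring_sum_le (rotBoard (2 * h + 1))
    (card_pos.1 (by rw [card_rotBoard_odd]; omega)) (univ.erase 0) univ hμ0 (by
      rw [hμ2, card_rotBoard_odd, card_erase_of_mem (mem_univ _), card_univ, Fintype.card_fin,
        le_div_iff₀ (by positivity)]
      push_cast
      nlinarith [mul_nonneg hL.le (sq_nonneg (h : ℝ))])
  refine ⟨a, ha, fun x y hx hy => ?_⟩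
  rcases hx 0 with h0 | h0
  · exact hsum x y hx hy (fun p _ hp => by simp at hp; rw [hp, h0]) (fun p _ hp => by simp at hp)
  · have := hsum (-x) (-y) (fun i => by rcases hx i with h | h <;> simp [h])
      (fun i => by rcases hy i with h | h <;> simp [h])
      (fun p _ hp => by simp at hp; simp [hp, h0]) (fun p _ hp => by simp at hp)
    simpa using this

/-- The orbit of the cell `q` under the reflections of the `2h × 2h` grid in its two axes. -/
def orbit (h : ℕ) (q : ℕ × ℕ) : Finset (Fin (2 * h) × Fin (2 * h)) :=
  univ.filter fun p => ((p.1 : ℕ) = q.1 ∨ (p.1 : ℕ) + q.1 + 1 = 2 * h) ∧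
    ((p.2 : ℕ) = q.2 ∨ (p.2 : ℕ) + q.2 + 1 = 2 * h)

theorem sum_orbit {M : Type*} [AddCommMonoid M] {h u v : ℕ} (hu : u < h) (hv : v < h)
    (f : Fin (2 * h) × Fin (2 * h) → M) :
    ∑ p ∈ orbit h (u, v), f p =
      f (⟨u, by omega⟩, ⟨v, by omega⟩) + f (⟨u, by omega⟩, ⟨2 * h - 1 - v, by omega⟩) +
      (f (⟨2 * h - 1 - u, by omega⟩, ⟨v, by omega⟩) +
        f (⟨2 * h - 1 - u, by omega⟩, ⟨2 * h - 1 - v, by omega⟩)) := by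
  have : orbit h (u, v) = ({⟨u, by omega⟩, ⟨2 * h - 1 - u, by omega⟩} : Finset (Fin (2 * h))) ×ˢ
      ({⟨v, by omega⟩, ⟨2 * h - 1 - v, by omega⟩} : Finset (Fin (2 * h))) := by
    ext p
    simp only [orbit, mem_filter, mem_univ, true_and, mem_product, mem_insert, mem_singleton,
      Fin.ext_iff]
    omega
  rw [this, sum_product, sum_pair (by simp only [ne_eq, Fin.mk.injEq]; omega),
    sum_pair (by simp only [ne_eq, Fin.mk.injEq]; omega),
    sum_pair (by simp only [ne_eq, Fin.mk.injEq]; omega)]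

theorem pairwiseDisjoint_orbit {h : ℕ} {K : Finset (ℕ × ℕ)} (hK : ∀ q ∈ K, q.1 < h ∧ q.2 < h) :
    (K : Set (ℕ × ℕ)).PairwiseDisjoint (orbit h) := by
  intro q hq q' hq' hne
  have h1 := hK q hq
  have h2 := hK q' hq'
  refine disjoint_left.2 fun p hp hp' => hne ?_
  simp only [orbit, mem_filter, mem_univ, true_and] at hp hp'
  ext <;> omega

theorem card_biUnion_orbit {h : ℕ} {K : Finset (ℕ × ℕ)} (hK : ∀ q ∈ K, q.1 < h ∧ q.2 < h) :
    #(K.biUnion (orbit h)) = 4 * #K := by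
  rw [card_eq_sum_ones, sum_biUnion (pairwiseDisjoint_orbit hK), card_eq_sum_ones, mul_sum]
  refine sum_congr rfl fun q hq => ?_
  rw [sum_orbit (hK q hq).1 (hK q hq).2]
  rfl

/-- The colouring of the `2h × 2h` grid with `-1` on one quadrant and `1` elsewhere. -/
def quadrantColoring (h : ℕ) (p : Fin (2 * h) × Fin (2 * h)) : ℤ :=
  if h ≤ (p.1 : ℕ) ∧ h ≤ (p.2 : ℕ) then -1 else 1

theorem quadrantColoring_eq (h : ℕ) (p : Fin (2 * h) × Fin (2 * h)) :
    quadrantColoring h p = 1 ∨ quadrantColoring h p = -1 := by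
  unfold quadrantColoring
  split_ifs <;> simp

theorem sum_biUnion_orbit_le {h : ℕ} {K : Finset (ℕ × ℕ)} (hK : ∀ q ∈ K, q.1 < h ∧ q.2 < h)
    {x y : Fin (2 * h) → ℤ} (hx : ∀ i, x i = 1 ∨ x i = -1) (hy : ∀ j, y j = 1 ∨ y j = -1) :
    ∑ p ∈ K.biUnion (orbit h), quadrantColoring h p * x p.1 * y p.2 ≤ 2 * #K := by
  rw [sum_biUnion (pairwiseDisjoint_orbit hK)]
  refine (sum_le_card_nsmul K _ 2 fun q hq => ?_).trans (by rw [nsmul_eq_mul, mul_comm])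
  obtain ⟨h1, h2⟩ := hK q hq
  rw [sum_orbit h1 h2]
  have e1 : ¬ h ≤ q.1 := by omega
  have e2 : ¬ h ≤ q.2 := by omega
  have e3 : h ≤ 2 * h - 1 - q.1 := by omega
  have e4 : h ≤ 2 * h - 1 - q.2 := by omega
  simp only [quadrantColoring, e1, e2, e3, e4, and_true, and_false, if_true, if_false]
  rcases hx ⟨q.1, by omega⟩ with a | a <;> rcases hx ⟨2 * h - 1 - q.1, by omega⟩ with b | b <;>
    rcases hy ⟨q.2, by omega⟩ with c | c <;> rcases hy ⟨2 * h - 1 - q.2, by omega⟩ with d | d <;>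
    rw [a, b, c, d] <;> norm_num

theorem discrepancy_rotBoard_even_le_of_lt {h : ℕ} (hh : h < 4) :
    ∃ a : Fin (2 * h) × Fin (2 * h) → ℤ, (∀ p, a p = 1 ∨ a p = -1) ∧
      ∀ x y : Fin (2 * h) → ℤ,
        (∀ i, x i = 1 ∨ x i = -1) → (∀ j, y j = 1 ∨ y j = -1) →
        ((∑ p ∈ rotBoard (2 * h), a p * x p.1 * y p.2 : ℤ) : ℝ)
          ≤ √(2 * Real.log 2) * ((2 * h : ℕ) : ℝ) ^ ((3 : ℝ)/2) := by
  refine ⟨quadrantColoring h, quadrantColoring_eq h, fun x y hx hy => ?_⟩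
  set K := (range h ×ˢ range h).filter fun q => h ≤ q.1 + q.2 + 1 with hKdef
  have hK : ∀ q ∈ K, q.1 < h ∧ q.2 < h := fun q hq => by
    simpa using (mem_filter.1 hq).1
  have hboard : rotBoard (2 * h) = K.biUnion (orbit h) := by
    ext p
    have h1 := p.1.isLt
    have h2 := p.2.isLt
    simp only [mem_rotBoard, mem_biUnion, hKdef, mem_filter, mem_product, mem_range, orbit,
      mem_univ, true_and]
    constructor
    · intro hp
      refine ⟨(min p.1 (2 * h - 1 - p.1), min p.2 (2 * h - 1 - p.2)), ?_⟩
      dsimp only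
      omega
    · rintro ⟨q, hq, hp⟩
      omega
  have hcard : 4 * #K = 2 * h ^ 2 + 2 * h := by
    rw [← card_biUnion_orbit hK, ← hboard, card_rotBoard_even]
  have hsum : ((∑ p ∈ rotBoard (2 * h), quadrantColoring h p * x p.1 * y p.2 : ℤ) : ℝ) ≤
      h ^ 2 + h := by
    have h1 := sum_biUnion_orbit_le hK hx hy
    rw [← hboard] at h1
    have h2 : (2 * #K : ℤ) = h ^ 2 + h := by zify at hcard; linarith
    rw [h2] at h1
    exact_mod_cast h1
  refine hsum.trans (le_of_sq_le_sq ?_ (by positivity))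
  rw [rpow_three_halves (by positivity), mul_pow, mul_pow, Real.sq_sqrt (by positivity),
    Real.sq_sqrt (by positivity)]
  have hL := Real.log_two_gt_d9
  interval_cases h <;> norm_num <;> linarith

theorem polynomial_bound {L : ℝ} (hL : 0.6931 < L) (hL' : L < 0.6932) (k : ℕ) :
    36 * ((k : ℝ) + 4) ^ 3 * L ≤ (L * (((k : ℝ) + 4) ^ 2 + 14 * (k + 4) - 24) + 9) ^ 2 := by
  have hP : (0 : ℝ) ≤ ((k : ℝ) + 4) ^ 2 + 14 * (k + 4) - 24 := by nlinarith [k.cast_nonneg (α := ℝ)]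
  calc 36 * ((k : ℝ) + 4) ^ 3 * L ≤ 36 * ((k : ℝ) + 4) ^ 3 * 0.6932 := by gcongr
    _ ≤ (0.6931 * (((k : ℝ) + 4) ^ 2 + 14 * (k + 4) - 24) + 9) ^ 2 := by
      rcases lt_or_ge k 22 with hk | hk
      · interval_cases k <;> norm_num
      · obtain ⟨m, rfl⟩ := Nat.exists_eq_add_of_le hk
        have hm : (0 : ℝ) ≤ m := m.cast_nonneg
        push_cast
        ring_nf
        nlinarith [pow_nonneg hm 2, pow_nonneg hm 3, pow_nonneg hm 4]
    _ ≤ _ := by gcongr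

/-- The rows (or columns) other than the two first and the two last ones. -/
def innerLines (n : ℕ) : Finset (Fin n) := univ.filter fun i => 2 ≤ (i : ℕ) ∧ (i : ℕ) + 2 < n

theorem card_innerLines (k : ℕ) : #(innerLines (2 * (k + 4))) = 2 * k + 4 := by
  have : (innerLines (2 * (k + 4))).map Fin.valEmbedding = Icc 2 (2 * k + 5) := by
    ext j
    simp only [mem_map, innerLines, mem_filter, mem_univ, true_and, mem_Icc,
      Fin.valEmbedding_apply]
    constructor
    · rintro ⟨j, h, rfl⟩
      omega
    · intro h
      exact ⟨⟨j, by omega⟩, by dsimp only; omega, rfl⟩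
  rw [← card_map Fin.valEmbedding, this, Nat.card_Icc]
  omega

/-- The part of `rotBoard n` in the inner rows and columns. -/
def innerBoard (n : ℕ) : Finset (Fin n × Fin n) :=
  (rotBoard n).filter fun p => p.1 ∈ innerLines n ∧ p.2 ∈ innerLines n

/-- Representatives of the orbits making up the rest of `rotBoard (2 * (k + 4))`. -/
def outerCells (k : ℕ) : Finset (ℕ × ℕ) :=
  {(0, k + 3), (1, k + 3), (1, k + 2), (k + 3, 0), (k + 3, 1), (k + 2, 1)}

theorem card_outerCells (k : ℕ) : #(outerCells k) = 6 := by
  rw [outerCells]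
  repeat rw [card_insert_of_notMem (by simp)]
  simp

theorem lt_of_mem_outerCells {k : ℕ} : ∀ q ∈ outerCells k, q.1 < k + 4 ∧ q.2 < k + 4 := by
  simp [outerCells]

theorem rotBoard_eq_union (k : ℕ) : rotBoard (2 * (k + 4)) =
    innerBoard (2 * (k + 4)) ∪ (outerCells k).biUnion (orbit (k + 4)) := by
  ext p
  have h1 := p.1.isLt
  have h2 := p.2.isLt
  simp only [mem_union, mem_rotBoard, mem_biUnion, outerCells, innerBoard, innerLines, mem_filter,
    mem_insert, mem_singleton, orbit, mem_univ, true_and, exists_eq_or_imp, exists_eq_left]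
  omega

theorem disjoint_innerBoard_outer (k : ℕ) :
    Disjoint (innerBoard (2 * (k + 4))) ((outerCells k).biUnion (orbit (k + 4))) := by
  refine disjoint_left.2 fun p hp => ?_
  have hp := (mem_filter.1 hp).2
  simp only [innerLines, mem_filter, mem_univ, true_and] at hp
  simp only [mem_biUnion, outerCells, mem_insert,
    mem_singleton, orbit, mem_filter, mem_univ, true_and, exists_eq_or_imp, exists_eq_left]
  omega

theorem card_innerBoard (k : ℕ) :
    #(innerBoard (2 * (k + 4))) + 24 = 2 * (k + 4) ^ 2 + 2 * (k + 4) := by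
  rw [← card_rotBoard_even, rotBoard_eq_union, card_union_of_disjoint (disjoint_innerBoard_outer k),
    card_biUnion_orbit lt_of_mem_outerCells, card_outerCells]

theorem discrepancy_rotBoard_even_le_of_ge (k : ℕ) :
    ∃ a : Fin (2 * (k + 4)) × Fin (2 * (k + 4)) → ℤ, (∀ p, a p = 1 ∨ a p = -1) ∧
      ∀ x y : Fin (2 * (k + 4)) → ℤ,
        (∀ i, x i = 1 ∨ x i = -1) → (∀ j, y j = 1 ∨ y j = -1) →
        ((∑ p ∈ rotBoard (2 * (k + 4)), a p * x p.1 * y p.2 : ℤ) : ℝ)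
          ≤ √(2 * Real.log 2) * ((2 * (k + 4) : ℕ) : ℝ) ^ ((3 : ℝ)/2) := by
  set L := Real.log 2
  have hL : 0.6931 < L := by linarith [Real.log_two_gt_d9]
  have hL' : L < 0.6932 := by linarith [Real.log_two_lt_d9]
  have hL0 : 0 < L := by linarith
  have hk0 : (0 : ℝ) ≤ k := k.cast_nonneg
  set μ : ℝ := √(2 * L) * ((2 * (k + 4) : ℕ) : ℝ) ^ ((3 : ℝ)/2) with hμ
  have hμ0 : 0 ≤ μ := by positivity
  have hμ2 : μ ^ 2 = 16 * L * (k + 4) ^ 3 := by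
    rw [hμ, rpow_three_halves (by positivity), mul_pow, mul_pow, Real.sq_sqrt (by positivity),
      Real.sq_sqrt (by positivity)]
    push_cast
    ring
  have hμ12 : 0 < μ - 12 := by
    refine sub_pos.2 (lt_of_pow_lt_pow_left₀ 2 hμ0 ?_)
    have : (4 : ℝ) ^ 3 ≤ (k + 4) ^ 3 := by gcongr; linarith
    rw [hμ2]
    nlinarith
  have hμle : 3 / 2 * μ ≤ L * (((k : ℝ) + 4) ^ 2 + 14 * (k + 4) - 24) + 9 := by
    refine le_of_sq_le_sq ?_ (by
      nlinarith [mul_nonneg hL0.le hk0, mul_nonneg hL0.le (sq_nonneg (k : ℝ))])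
    rw [mul_pow, hμ2]
    linarith [polynomial_bound hL hL' k]
  have hdisj := disjoint_innerBoard_outer k
  have hIcard : (#(innerBoard (2 * (k + 4))) : ℝ) = 2 * (k + 4) ^ 2 + 2 * (k + 4) - 24 := by
    have : (#(innerBoard (2 * (k + 4))) : ℝ) + 24 = 2 * (k + 4) ^ 2 + 2 * (k + 4) := by
      exact_mod_cast card_innerBoard k
    linarith
  have hIpos : 0 < #(innerBoard (2 * (k + 4))) := by nlinarith [card_innerBoard k]
  have hexp : ((#(innerLines (2 * (k + 4))) + #(innerLines (2 * (k + 4))) : ℕ) : ℝ) * L ≤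
      (μ - 12) ^ 2 / (2 * #(innerBoard (2 * (k + 4)))) := by
    have hIpos' : (0 : ℝ) < #(innerBoard (2 * (k + 4))) := by exact_mod_cast hIpos
    rw [le_div_iff₀ (by positivity), card_innerLines, hIcard, sub_sq, hμ2]
    push_cast
    linarith
  obtain ⟨a, ha, hsum⟩ := exists_coloring_sum_le _ (card_pos.1 hIpos) _ _ hμ12 hexp
  refine ⟨fun p =>
    if p ∈ innerBoard (2 * (k + 4)) then a p else quadrantColoring (k + 4) p, fun p => ?_,
    fun x y hx hy => ?_⟩
  · dsimp only
    split_ifs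
    exacts [ha p, quadrantColoring_eq _ p]
  rw [rotBoard_eq_union, sum_union hdisj]
  beta_reduce
  have h1 := hsum x y hx hy
    (fun p hp h => absurd (mem_filter.1 hp).2.1 h)
    (fun p hp h => absurd (mem_filter.1 hp).2.2 h)
  have h2 : ((∑ p ∈ (outerCells k).biUnion (orbit (k + 4)),
      quadrantColoring (k + 4) p * x p.1 * y p.2 : ℤ) : ℝ) ≤ 12 := by
    have := sum_biUnion_orbit_le (lt_of_mem_outerCells (k := k)) hx hy
    rw [card_outerCells] at this
    exact_mod_cast this
  rw [sum_congr rfl fun p hp => by rw [if_pos hp],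
    sum_congr (s₁ := (outerCells k).biUnion _) rfl
      fun p hp => by rw [if_neg (disjoint_right.1 hdisj hp)]]
  push_cast at h1 h2 ⊢
  linarith

/-- For the rotated inscribed square board, the maximum discrepancy `F(H)`
satisfies `F(H) ≥ (1+o(1))·(2/3)·√(2/π)·n^(3/2)` and
`F(H) ≤ √(2 ln 2)·n^(3/2)`. -/
theorem stmt_15 :
    (∀ ε : ℝ, 0 < ε → ∃ N : ℕ, ∀ n : ℕ, N ≤ n →
      ∀ a : Fin n × Fin n → ℤ, (∀ p ∈ rotBoard n, a p = 1 ∨ a p = -1) →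
        ∃ x y : Fin n → ℤ,
          (∀ i, x i = 1 ∨ x i = -1) ∧ (∀ j, y j = 1 ∨ y j = -1) ∧
          (2/3 * Real.sqrt (2 / Real.pi) - ε) * (n : ℝ) ^ ((3 : ℝ)/2)
            ≤ ((∑ p ∈ rotBoard n, a p * x p.1 * y p.2 : ℤ) : ℝ)) ∧
    (∀ n : ℕ, ∃ a : Fin n × Fin n → ℤ, (∀ p ∈ rotBoard n, a p = 1 ∨ a p = -1) ∧
      ∀ x y : Fin n → ℤ,
        (∀ i, x i = 1 ∨ x i = -1) → (∀ j, y j = 1 ∨ y j = -1) →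
        ((∑ p ∈ rotBoard n, a p * x p.1 * y p.2 : ℤ) : ℝ)
          ≤ Real.sqrt (2 * Real.log 2) * (n : ℝ) ^ ((3 : ℝ)/2)) := by
  refine ⟨le_discrepancy_rotBoard, fun n => ?_⟩
  obtain ⟨h, rfl | rfl⟩ := Nat.even_or_odd' n
  · rcases lt_or_ge h 4 with hh | hh
    · obtain ⟨a, ha, hsum⟩ := discrepancy_rotBoard_even_le_of_lt hh
      exact ⟨a, fun p _ => ha p, hsum⟩
    · obtain ⟨k, rfl⟩ := Nat.exists_eq_add_of_le' hh
      obtain ⟨a, ha, hsum⟩ := discrepancy_rotBoard_even_le_of_ge k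
      exact ⟨a, fun p _ => ha p, hsum⟩
  · obtain ⟨a, ha, hsum⟩ := discrepancy_rotBoard_odd_le h
    exact ⟨a, fun p _ => ha p, hsum⟩
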